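/- arXiv:math/0611166 — 2 statements merged into one kernel-verified Lean document; each statement's English description precedes it below -/
import Mathlib

section
/- A function C : [0,1]^n → [0,1] is an absolutely continuous n-dimensional copula if and only if there exist Borel functions g̃_{i_1,…,i_c} : [0,1]^c → ℝ, 1 ≤ i_1 < ⋯ < i_c ≤ n, c = 2,…,n, satisfying: (A4) ∫_{[0,1]^c} |g̃_{i_1,…,i_c}(t_{i_1},…,t_{i_c})| dt_{i_1}⋯dt_{i_c} < ∞; (A5) ∫_0^1 g̃_{i_1,…,i_c}(V_{i_1},…,V_{i_{k−1}}, t, V_{i_{k+1}},…,V_{i_c}) dt = 0 almost surely for every k = 1,…,c; (A6) Ũ_n(V_1,…,V_n) := Σ_{c=2}^{n} Σ_{1≤i_1<⋯<i_c≤n} g̃_{i_1,…,i_c}(V_{i_1},…,V_{i_c}) ≥ −1 almost surely; and such that C(u_1,…,u_n) = ∫_0^{u_1}⋯∫_0^{u_n} (1 + Ũ_n(t_1,…,t_n)) dt_1⋯dt_n. -/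
open MeasureTheory Finset

/-- A function `g` on `ℝⁿ` depends only on the coordinates in `S`
(i.e., it is really a function of the variables `x_i`, `i ∈ S`). -/
def DependsOnlyOn {n : ℕ} (S : Finset (Fin n)) (g : (Fin n → ℝ) → ℝ) : Prop :=
  ∀ x y : Fin n → ℝ, (∀ i ∈ S, x i = y i) → g x = g y

/-- The sum of U-statistics `U_n(x) = Σ_{c=2}^n Σ_{i_1<⋯<i_c} g_{i_1,…,i_c}(x_{i_1},…,x_{i_c})`,
where the kernel for the index set `S = {i_1,…,i_c}` is `g S`. -/
noncomputable def Usum {n : ℕ} (g : Finset (Fin n) → (Fin n → ℝ) → ℝ) (x : Fin n → ℝ) : ℝ :=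
  ∑ S ∈ Finset.univ.filter (fun S : Finset (Fin n) => 2 ≤ S.card), g S x

/-- Conditions A1 (integrability), A2 (degeneracy: zero mean in each argument, a.s. in
the remaining arguments) and A3 (positive definiteness: `U_n ≥ -1` a.s.) for a family of
Borel kernels `g_{i_1,…,i_c}`, with respect to independent random variables `ξ_1,…,ξ_n`
with distributions `μ_1,…,μ_n` (whose joint law is `Measure.pi μ`). -/
def IsKernelSystem {n : ℕ} (μ : Fin n → Measure ℝ) (g : Finset (Fin n) → (Fin n → ℝ) → ℝ) :
    Prop :=
  (∀ S : Finset (Fin n), 2 ≤ S.card →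
      Measurable (g S) ∧ DependsOnlyOn S (g S) ∧
      Integrable (g S) (Measure.pi μ) ∧
      ∀ k ∈ S, ∀ᵐ x ∂Measure.pi μ, ∫ t, g S (Function.update x k t) ∂μ k = 0) ∧
  (∀ᵐ x ∂Measure.pi μ, -1 ≤ Usum g x)

/-- The uniform distribution on `[0,1]`: the law of each `V_i`. -/
noncomputable def unifMeasure : Measure ℝ := volume.restrict (Set.Icc (0 : ℝ) 1)

instance : IsProbabilityMeasure unifMeasure :=
  ⟨by simp [unifMeasure]⟩

section AlternatingSums

variable {α : Type*} [DecidableEq α]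

lemma sum_powerset_insert_neg_one_pow {k : α} {R : Finset α} (hk : k ∉ R) (a : Finset α → ℝ) :
    ∑ T ∈ (insert k R).powerset, (-1) ^ ((insert k R).card - T.card) * a T =
      ∑ T ∈ R.powerset, (-1) ^ (R.card - T.card) * (a (insert k T) - a T) := by
  rw [Finset.sum_powerset_insert hk, ← Finset.sum_add_distrib]
  refine Finset.sum_congr rfl fun T hT => ?_
  have hTR := Finset.mem_powerset.1 hT
  rw [Finset.card_insert_of_notMem hk, Finset.card_insert_of_notMem fun h => hk (hTR h),
    Nat.add_sub_add_right, Nat.succ_sub (Finset.card_le_card hTR), pow_succ]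
  ring

/-- Möbius inversion on the Boolean lattice. -/
lemma sum_powerset_sum_powerset_neg_one_pow (a : Finset α → ℝ) (R : Finset α) :
    ∑ S ∈ R.powerset, ∑ T ∈ S.powerset, (-1) ^ (S.card - T.card) * a T = a R := by
  induction R using Finset.induction_on generalizing a with
  | empty => simp
  | insert k R hk ih =>
    rw [Finset.sum_powerset_insert hk, ← Finset.sum_add_distrib, ← ih fun T => a (insert k T)]
    refine Finset.sum_congr rfl fun S hS => ?_
    rw [sum_powerset_insert_neg_one_pow fun h => hk (Finset.mem_powerset.1 hS h),
      ← Finset.sum_add_distrib]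
    exact Finset.sum_congr rfl fun T _ => by ring

end AlternatingSums

section Hoeffding

variable {n : ℕ} (μ : Fin n → Measure ℝ) {f : (Fin n → ℝ) → ℝ}
  {g : Finset (Fin n) → (Fin n → ℝ) → ℝ}

/-- Conditional expectation of `f` given the coordinates in `T`, under the product measure. -/
noncomputable def condProj (f : (Fin n → ℝ) → ℝ) (T : Finset (Fin n)) (x : Fin n → ℝ) : ℝ :=
  ∫ y, f (T.piecewise x y) ∂Measure.pi μ

/-- Hoeffding component of `f` for the index set `S`. -/
noncomputable def hoeffding (f : (Fin n → ℝ) → ℝ) (S : Finset (Fin n)) (x : Fin n → ℝ) : ℝ :=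
  ∑ T ∈ S.powerset, (-1) ^ (S.card - T.card) * condProj μ f T x

lemma condProj_congr {T : Finset (Fin n)} {x y : Fin n → ℝ} (h : ∀ i ∈ T, x i = y i) :
    condProj μ f T x = condProj μ f T y := by
  unfold condProj
  congr! 3 with z
  ext i
  by_cases hi : i ∈ T <;> simp [hi, h]

lemma condProj_empty (x : Fin n → ℝ) : condProj μ f ∅ x = ∫ y, f y ∂Measure.pi μ := by
  simp [condProj]

lemma dependsOnlyOn_hoeffding (S : Finset (Fin n)) : DependsOnlyOn S (hoeffding μ f S) :=
  fun _ _ h => Finset.sum_congr rfl fun T hT => by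
    rw [condProj_congr μ fun i hi => h i (Finset.mem_powerset.1 hT hi)]

lemma IsKernelSystem.integrable_Usum (hg : IsKernelSystem μ g) :
    Integrable (Usum g) (Measure.pi μ) :=
  integrable_finsetSum _ fun S hS => (hg.1 S (Finset.mem_filter.1 hS).2).2.2.1

/-- The measure with density `1 + Usum g` with respect to the product measure. -/
noncomputable def kernelMeasure (g : Finset (Fin n) → (Fin n → ℝ) → ℝ) : Measure (Fin n → ℝ) :=
  (Measure.pi μ).withDensity fun x => ENNReal.ofReal (1 + Usum g x)

variable [∀ i, IsProbabilityMeasure (μ i)]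

/-- Resampling one coordinate preserves the product measure. -/
lemma measurePreserving_update (k : Fin n) :
    MeasurePreserving (fun p : (Fin n → ℝ) × ℝ => Function.update p.1 k p.2)
      ((Measure.pi μ).prod (μ k)) (Measure.pi μ) := by
  have hm : Measurable (fun p : (Fin n → ℝ) × ℝ => Function.update p.1 k p.2) := by
    refine measurable_pi_iff.2 fun i => ?_
    by_cases h : i = k
    · subst h; simpa using measurable_snd
    · simp only [Function.update_of_ne h]; fun_prop
  refine ⟨hm, (Measure.pi_eq fun s hs => ?_).symm⟩
  rw [Measure.map_apply hm (MeasurableSet.univ_pi hs)]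
  have : (fun p : (Fin n → ℝ) × ℝ => Function.update p.1 k p.2) ⁻¹' (Set.univ.pi s)
      = (Set.univ.pi (Function.update s k Set.univ)) ×ˢ s k := by
    ext p
    simp only [Set.mem_preimage, Set.mem_univ_pi, Set.mem_prod]
    constructor
    · refine fun h => ⟨fun i => ?_, by simpa using h k⟩
      by_cases hi : i = k
      · subst hi; simp
      · simpa [Function.update_of_ne hi] using h i
    · rintro ⟨h, h'⟩ i
      by_cases hi : i = k
      · subst hi; simpa using h'
      · simpa [Function.update_of_ne hi] using h i
  rw [this, Measure.prod_prod, Measure.pi_pi, ← Finset.mul_prod_erase _ _ (Finset.mem_univ k),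
    ← Finset.mul_prod_erase Finset.univ (fun i => μ i (s i)) (Finset.mem_univ k)]
  simp only [Function.update_self, measure_univ, one_mul]
  rw [mul_comm]
  congr 1
  exact Finset.prod_congr rfl fun i hi => by rw [Function.update_of_ne (Finset.ne_of_mem_erase hi)]

/-- Gluing two independent samples of a product measure along a set of coordinates gives again
a sample of that measure. -/
lemma measurePreserving_piecewise (T : Finset (Fin n)) :
    MeasurePreserving (fun p : (Fin n → ℝ) × (Fin n → ℝ) => T.piecewise p.1 p.2)
      ((Measure.pi μ).prod (Measure.pi μ)) (Measure.pi μ) := by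
  have hm : Measurable (fun p : (Fin n → ℝ) × (Fin n → ℝ) => T.piecewise p.1 p.2) := by
    refine measurable_pi_iff.2 fun i => ?_
    by_cases h : i ∈ T
    · simp only [Finset.piecewise_eq_of_mem _ _ _ h]; fun_prop
    · simp only [Finset.piecewise_eq_of_notMem _ _ _ h]; fun_prop
  refine ⟨hm, (Measure.pi_eq fun s hs => ?_).symm⟩
  rw [Measure.map_apply hm (MeasurableSet.univ_pi hs)]
  have : (fun p : (Fin n → ℝ) × (Fin n → ℝ) => T.piecewise p.1 p.2) ⁻¹' (Set.univ.pi s)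
      = (Set.univ.pi fun i => if i ∈ T then s i else Set.univ) ×ˢ
        (Set.univ.pi fun i => if i ∈ T then Set.univ else s i) := by
    ext p
    simp only [Set.mem_preimage, Set.mem_univ_pi, Set.mem_prod, ← forall_and]
    refine forall_congr' fun i => ?_
    by_cases h : i ∈ T <;> simp [h]
  rw [this, Measure.prod_prod, Measure.pi_pi, Measure.pi_pi, ← Finset.prod_mul_distrib]
  refine Finset.prod_congr rfl fun i _ => ?_
  by_cases h : i ∈ T <;> simp [h]

/-- A function that is degenerate in the coordinate `k` has zero integral over every set that does
not constrain this coordinate. -/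
lemma setIntegral_eq_zero_of_degenerate {h : (Fin n → ℝ) → ℝ} (hi : Integrable h (Measure.pi μ))
    (k : Fin n) (hk : ∀ᵐ x ∂Measure.pi μ, ∫ t, h (Function.update x k t) ∂μ k = 0)
    {B : Set (Fin n → ℝ)} (hB : MeasurableSet B)
    (hBk : ∀ x t, Function.update x k t ∈ B ↔ x ∈ B) :
    ∫ x in B, h x ∂Measure.pi μ = 0 := by
  have mp := measurePreserving_update μ k
  have hI := hi.indicator hB
  rw [← integral_indicator hB, ← mp.map_eq, integral_map mp.measurable.aemeasurable
    (by rw [mp.map_eq]; exact hI.aestronglyMeasurable), 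
    integral_prod (fun p : (Fin n → ℝ) × ℝ => B.indicator h (Function.update p.1 k p.2))
      (mp.integrable_comp_of_integrable hI)]
  refine integral_eq_zero_of_ae (hk.mono fun x hx => ?_)
  by_cases hxB : x ∈ B <;> simp [Set.indicator, hBk, hxB, hx]

lemma measurable_condProj (hf : Measurable f) (T : Finset (Fin n)) :
    Measurable (condProj μ f T) :=
  (StronglyMeasurable.integral_prod_right (f := fun x y => f (T.piecewise x y))
    (hf.comp (measurePreserving_piecewise μ T).measurable).stronglyMeasurable).measurable

lemma integrable_condProj (hi : Integrable f (Measure.pi μ)) (T : Finset (Fin n)) :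
    Integrable (condProj μ f T) (Measure.pi μ) :=
  ((measurePreserving_piecewise μ T).integrable_comp_of_integrable hi).integral_prod_left

lemma condProj_univ (x : Fin n → ℝ) : condProj μ f Finset.univ x = f x := by
  simp [condProj]

/-- Averaging `condProj` over a coordinate of `T` removes this coordinate from `T`. -/
lemma integral_condProj_update (hi : Integrable f (Measure.pi μ)) {T : Finset (Fin n)}
    {k : Fin n} (hk : k ∉ T) :
    ∀ᵐ x ∂Measure.pi μ,
      Integrable (fun t => condProj μ f (insert k T) (Function.update x k t)) (μ k) ∧
      ∫ t, condProj μ f (insert k T) (Function.update x k t) ∂μ k = condProj μ f T x := by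
  have mp := measurePreserving_update μ k
  filter_upwards [((measurePreserving_piecewise μ T).integrable_comp_of_integrable hi).prod_right_ae]
    with x hx
  have hx' : Integrable (fun y => f (T.piecewise x y)) (Measure.pi μ) := hx
  have heq : (fun t => condProj μ f (insert k T) (Function.update x k t)) =
      fun t => ∫ y, f (T.piecewise x (Function.update y k t)) ∂Measure.pi μ := by
    ext t
    unfold condProj
    congr! 3 with y
    ext i
    by_cases hik : i = k
    · subst hik; simp [hk]
    · by_cases hiT : i ∈ T <;> simp [hik, hiT]
  have hI := mp.integrable_comp_of_integrable hx'
  rw [heq]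
  refine ⟨hI.integral_prod_right, ?_⟩
  rw [condProj, ← mp.map_eq, integral_map mp.measurable.aemeasurable
    (by rw [mp.map_eq]; exact hx'.aestronglyMeasurable), mp.map_eq]
  exact (integral_prod_symm _ hI).symm

lemma measurable_hoeffding (hf : Measurable f) (S : Finset (Fin n)) :
    Measurable (hoeffding μ f S) :=
  Finset.measurable_fun_sum _ fun T _ => (measurable_condProj μ hf T).const_mul _

lemma integrable_hoeffding (hi : Integrable f (Measure.pi μ)) (S : Finset (Fin n)) :
    Integrable (hoeffding μ f S) (Measure.pi μ) :=
  integrable_finsetSum _ fun T _ => (integrable_condProj μ hi T).const_mul _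

/-- Hoeffding components are degenerate. -/
lemma integral_hoeffding_update (hi : Integrable f (Measure.pi μ)) {S : Finset (Fin n)}
    {k : Fin n} (hk : k ∈ S) :
    ∀ᵐ x ∂Measure.pi μ, ∫ t, hoeffding μ f S (Function.update x k t) ∂μ k = 0 := by
  obtain ⟨R, hkR, rfl⟩ : ∃ R, k ∉ R ∧ S = insert k R :=
    ⟨S.erase k, Finset.notMem_erase k S, (Finset.insert_erase hk).symm⟩
  have hall : ∀ᵐ x ∂Measure.pi μ, ∀ T ∈ R.powerset,
      Integrable (fun t => condProj μ f (insert k T) (Function.update x k t)) (μ k) ∧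
      ∫ t, condProj μ f (insert k T) (Function.update x k t) ∂μ k = condProj μ f T x :=
    (ae_ball_iff (Finset.countable_toSet _)).2 fun T hT =>
      integral_condProj_update μ hi fun h => hkR (Finset.mem_powerset.1 hT h)
  filter_upwards [hall] with x hx
  have hconst : ∀ T ∈ R.powerset, ∀ t,
      condProj μ f T (Function.update x k t) = condProj μ f T x := fun T hT t =>
    condProj_congr μ fun i hi => Function.update_of_ne
      (by rintro rfl; exact hkR (Finset.mem_powerset.1 hT hi)) _ _
  have hsplit : (fun t => hoeffding μ f (insert k R) (Function.update x k t)) = fun t =>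
      ∑ T ∈ R.powerset, (-1) ^ (R.card - T.card) *
        (condProj μ f (insert k T) (Function.update x k t) - condProj μ f T x) := by
    ext t
    rw [hoeffding, sum_powerset_insert_neg_one_pow hkR]
    exact Finset.sum_congr rfl fun T hT => by rw [hconst T hT]
  rw [hsplit, integral_finsetSum _ fun T hT =>
    Integrable.const_mul (f := fun t => condProj μ f (insert k T) (Function.update x k t) -
      condProj μ f T x) ((hx T hT).1.sub (integrable_const _)) _]
  refine Finset.sum_eq_zero fun T hT => ?_
  rw [integral_const_mul, integral_sub (hx T hT).1 (integrable_const _), (hx T hT).2]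
  simp

/-- The Hoeffding components sum to the function. -/
lemma sum_hoeffding (x : Fin n → ℝ) : ∑ S, hoeffding μ f S x = f x := by
  simpa [hoeffding, condProj_univ] using
    sum_powerset_sum_powerset_neg_one_pow (fun T => condProj μ f T x) Finset.univ

/-- If the `i`-th marginal of the measure with density `f` is `μ i`, then the conditional
expectation of `f` given the `i`-th coordinate is `1`. -/
lemma condProj_singleton_ae (hi : Integrable f (Measure.pi μ)) (i : Fin n)
    (hmarg : ∀ A : Set ℝ, MeasurableSet A →
      ∫ x in (fun x => x i) ⁻¹' A, f x ∂Measure.pi μ = (μ i).real A) :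
    ∀ᵐ x ∂Measure.pi μ, condProj μ f {i} x = 1 := by
  have mp := measurePreserving_update μ i
  have hI := mp.integrable_comp_of_integrable hi
  have hφ : (fun t => ∫ y, f (Function.update y i t) ∂Measure.pi μ) =ᵐ[μ i] fun _ => (1 : ℝ) := by
    refine Integrable.ae_eq_of_forall_setIntegral_eq _ _ hI.integral_prod_right
      (integrable_const _) fun A hA _ => ?_
    have hB : MeasurableSet ((fun x : Fin n → ℝ => x i) ⁻¹' A) := measurable_pi_apply i hA
    have hIB := hi.indicator hB
    have hIB' := mp.integrable_comp_of_integrable hIB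
    have := hmarg A hA
    rw [← integral_indicator hB, ← mp.map_eq, integral_map mp.measurable.aemeasurable
      (by rw [mp.map_eq]; exact hIB.aestronglyMeasurable), integral_prod_symm
      (fun p : (Fin n → ℝ) × ℝ => Set.indicator ((fun x : Fin n → ℝ => x i) ⁻¹' A) f
        (Function.update p.1 i p.2)) hIB'] at this
    rw [← integral_indicator hA]
    simp only [integral_const, smul_eq_mul, mul_one, measureReal_restrict_apply_univ]
    rw [← this]
    congr! 2 with t
    by_cases ht : t ∈ A <;> simp [Set.indicator, ht]
  filter_upwards [(measurePreserving_eval μ i).quasiMeasurePreserving.ae hφ] with x hx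
  rw [← hx, condProj]
  congr! 3 with y
  ext j
  by_cases hj : j = i
  · subst hj; simp
  · simp [hj]

/-- A density with marginals `μ i` is `1` plus the sum of its Hoeffding components of order at
least two. -/
lemma one_add_Usum_hoeffding_ae (hi : Integrable f (Measure.pi μ))
    (h1 : ∫ x, f x ∂Measure.pi μ = 1)
    (hmarg : ∀ i, ∀ A : Set ℝ, MeasurableSet A →
      ∫ x in (fun x => x i) ⁻¹' A, f x ∂Measure.pi μ = (μ i).real A) :
    ∀ᵐ x ∂Measure.pi μ, 1 + Usum (hoeffding μ f) x = f x := by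
  filter_upwards [ae_all_iff.2 fun i => condProj_singleton_ae μ hi i (hmarg i)] with x hx
  rw [← sum_hoeffding μ (f := f) x, ← Finset.sum_filter_add_sum_filter_not Finset.univ
    (fun S : Finset (Fin n) => 2 ≤ S.card), Usum, add_comm]
  congr 1
  rw [Finset.sum_eq_single_of_mem ∅ (by simp)]
  · simp [hoeffding, condProj_empty, h1]
  · intro S hS hne
    have hc : S.card = 1 := by
      have := Finset.card_pos.2 (Finset.nonempty_iff_ne_empty.2 hne)
      have := (Finset.mem_filter.1 hS).2
      omega
    obtain ⟨i, rfl⟩ := Finset.card_eq_one.1 hc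
    rw [hoeffding, ← insert_empty_eq, Finset.sum_powerset_insert (Finset.notMem_empty i)]
    simp [condProj_empty, h1, hx]

lemma IsKernelSystem.setIntegral_one_add_Usum (hg : IsKernelSystem μ g) {B : Set (Fin n → ℝ)}
    (hB : MeasurableSet B) (hBk : ∀ S : Finset (Fin n), 2 ≤ S.card →
      ∃ k ∈ S, ∀ x t, Function.update x k t ∈ B ↔ x ∈ B) :
    ∫ x in B, (1 + Usum g x) ∂Measure.pi μ = (Measure.pi μ).real B := by
  have hz : ∫ x in B, Usum g x ∂Measure.pi μ = 0 := by
    unfold Usum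
    rw [integral_finsetSum _ fun S hS =>
      (hg.1 S (Finset.mem_filter.1 hS).2).2.2.1.integrableOn]
    refine Finset.sum_eq_zero fun S hS => ?_
    have hS' := (Finset.mem_filter.1 hS).2
    obtain ⟨k, hk, hkB⟩ := hBk S hS'
    exact setIntegral_eq_zero_of_degenerate μ (hg.1 S hS').2.2.1 k ((hg.1 S hS').2.2.2 k hk) hB hkB
  rw [integral_add (integrable_const _) hg.integrable_Usum.integrableOn, hz]
  simp

lemma IsKernelSystem.kernelMeasure_apply (hg : IsKernelSystem μ g) {B : Set (Fin n → ℝ)}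
    (hB : MeasurableSet B) :
    kernelMeasure μ g B = ENNReal.ofReal (∫ x in B, (1 + Usum g x) ∂Measure.pi μ) := by
  rw [kernelMeasure, withDensity_apply _ hB, ofReal_integral_eq_lintegral_ofReal
    (f := fun x => 1 + Usum g x) ((integrable_const _).add hg.integrable_Usum).integrableOn
    (ae_restrict_of_ae (hg.2.mono fun x hx => by simp only [Pi.zero_apply]; linarith))]

lemma IsKernelSystem.isProbabilityMeasure (hg : IsKernelSystem μ g) :
    IsProbabilityMeasure (kernelMeasure μ g) := by
  refine ⟨?_⟩
  rw [hg.kernelMeasure_apply μ MeasurableSet.univ, hg.setIntegral_one_add_Usum μ MeasurableSet.univ]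
  · simp
  · intro S hS
    obtain ⟨k, hk⟩ := Finset.card_pos.1 (by omega : 0 < S.card)
    exact ⟨k, hk, by simp⟩

lemma IsKernelSystem.map_eval (hg : IsKernelSystem μ g) (i : Fin n) :
    (kernelMeasure μ g).map (fun x => x i) = μ i := by
  ext A hA
  have hB : MeasurableSet ((fun x : Fin n → ℝ => x i) ⁻¹' A) := measurable_pi_apply i hA
  rw [Measure.map_apply (measurable_pi_apply i) hA, hg.kernelMeasure_apply μ hB,
    hg.setIntegral_one_add_Usum μ hB, ofReal_measureReal]
  · exact (measurePreserving_eval μ i).measure_preimage hA.nullMeasurableSet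
  · intro S hS
    obtain ⟨k, hk, hki⟩ := Finset.exists_mem_ne (by omega : 1 < S.card) i
    exact ⟨k, hk, fun x t => by simp [Function.update_of_ne hki.symm]⟩

end Hoeffding

/-- Theorem 3.2: `C` is an absolutely continuous `n`-dimensional copula (i.e. the joint cdf of
`n` random variables uniformly distributed on `[0,1]`, absolutely continuous w.r.t. Lebesgue
measure on `[0,1]ⁿ`) if and only if there are kernels `g̃_{i_1,…,i_c}` satisfying A4–A6
(integrability, degeneracy and positive definiteness w.r.t. independent uniform `V_i`'s) with
`C(u₁,…,uₙ) = ∫_0^{u₁}⋯∫_0^{uₙ} (1 + Ũ_n(t₁,…,tₙ)) dt₁⋯dtₙ`. -/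
theorem statement1 (n : ℕ) (C : (Fin n → ℝ) → ℝ) :
    (∃ ν : Measure (Fin n → ℝ), IsProbabilityMeasure ν ∧
        (∀ i, ν.map (fun x => x i) = unifMeasure) ∧
        ν ≪ Measure.pi (fun _ : Fin n => unifMeasure) ∧
        ∀ u : Fin n → ℝ, (∀ i, u i ∈ Set.Icc (0 : ℝ) 1) → C u = (ν (Set.Iic u)).toReal) ↔
      ∃ g : Finset (Fin n) → (Fin n → ℝ) → ℝ,
        IsKernelSystem (fun _ : Fin n => unifMeasure) g ∧
        ∀ u : Fin n → ℝ, (∀ i, u i ∈ Set.Icc (0 : ℝ) 1) →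
          C u = ∫ t in Set.Iic u, (1 + Usum g t) ∂Measure.pi (fun _ : Fin n => unifMeasure) := by
  constructor
  · rintro ⟨ν, hν, hmap, hac, hC⟩
    set μ : Fin n → Measure ℝ := fun _ => unifMeasure
    have hf : Measurable fun x => (ν.rnDeriv (Measure.pi μ) x).toReal :=
      (Measure.measurable_rnDeriv _ _).ennreal_toReal
    have hi : Integrable (fun x => (ν.rnDeriv (Measure.pi μ) x).toReal) (Measure.pi μ) :=
      Measure.integrable_toReal_rnDeriv
    have h1 : ∫ x, (ν.rnDeriv (Measure.pi μ) x).toReal ∂Measure.pi μ = 1 := by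
      rw [Measure.integral_toReal_rnDeriv hac]; simp
    have hae := one_add_Usum_hoeffding_ae μ hi h1 fun i A hA => by
      rw [Measure.setIntegral_toReal_rnDeriv hac, show μ i = _ from (hmap i).symm,
        measureReal_def, measureReal_def, Measure.map_apply (measurable_pi_apply i) hA]
    refine ⟨hoeffding μ fun x => (ν.rnDeriv (Measure.pi μ) x).toReal,
      ⟨fun S _ => ⟨measurable_hoeffding μ hf S, dependsOnlyOn_hoeffding μ S,
        integrable_hoeffding μ hi S, fun k hk => integral_hoeffding_update μ hi hk⟩, ?_⟩, ?_⟩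
    · filter_upwards [hae] with x hx
      have : 0 ≤ (ν.rnDeriv (Measure.pi μ) x).toReal := ENNReal.toReal_nonneg
      linarith
    · intro u hu
      rw [hC u hu, integral_congr_ae (ae_restrict_of_ae hae),
        Measure.setIntegral_toReal_rnDeriv hac, measureReal_def]
  · rintro ⟨g, hg, hC⟩
    refine ⟨kernelMeasure _ g, hg.isProbabilityMeasure, hg.map_eval _,
      withDensity_absolutelyContinuous _ _, fun u hu => ?_⟩
    rw [hC u hu, hg.kernelMeasure_apply _ measurableSet_Iic, ENNReal.toReal_ofReal]
    exact integral_nonneg_of_ae (ae_restrict_of_ae (hg.2.mono fun x hx => by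
      simp only [Pi.zero_apply]; linarith))
end

section
/- Random variables X_1,…,X_n with E X_k = 0, k = 1,…,n, whose joint distribution possesses the canonical representation with kernels g satisfying A1–A3, are orthogonal (i.e., E X_i X_j = 0 for all 1 ≤ i < j ≤ n) if and only if E[ ξ_i ξ_j g_{ij}(ξ_i, ξ_j) ] = 0 for all 1 ≤ i < j ≤ n. -/
open MeasureTheory Finset

section Resampling

variable {ι : Type*} [Fintype ι] [DecidableEq ι] {X : ι → Type*} [∀ i, MeasurableSpace (X i)]
  {μ : ∀ i, Measure (X i)} [∀ i, IsProbabilityMeasure (μ i)]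

/-- Replacing one coordinate of a product-distributed point by an independent copy preserves the
product measure. -/
theorem measurePreserving_update_pi (k : ι) :
    MeasurePreserving (fun p : (∀ i, X i) × X k => Function.update p.1 k p.2)
      ((Measure.pi μ).prod (μ k)) (Measure.pi μ) := by
  refine ⟨measurable_update', (Measure.pi_eq fun s hs => ?_).symm⟩
  rw [Measure.map_apply measurable_update' (.univ_pi hs)]
  have hpre : (fun p : (∀ i, X i) × X k => Function.update p.1 k p.2) ⁻¹' Set.univ.pi s
      = Set.univ.pi (Function.update s k Set.univ) ×ˢ s k := by
    ext p
    simp only [Set.mem_preimage, Set.mem_univ_pi, Set.mem_prod]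
    constructor
    · refine fun h => ⟨fun i => ?_, by simpa using h k⟩
      rcases eq_or_ne i k with rfl | hi
      · simp
      · simpa [hi] using h i
    · rintro ⟨h, hk⟩ i
      rcases eq_or_ne i k with rfl | hi
      · simpa using hk
      · simpa [hi] using h i
  rw [hpre, Measure.prod_prod, Measure.pi_pi, ← Finset.prod_erase_mul _ _ (Finset.mem_univ k),
    ← Finset.prod_erase_mul (a := k) _ (fun i => μ i (s i)) (Finset.mem_univ k)]
  simp only [Function.update_self, measure_univ, mul_one]
  congr 1
  refine Finset.prod_congr rfl fun i hi => ?_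
  rw [Function.update_of_ne (Finset.ne_of_mem_erase hi)]

theorem integral_pi_eq_integral_integral_update {f : (∀ i, X i) → ℝ}
    (hf : Integrable f (Measure.pi μ)) (k : ι) :
    ∫ x, f x ∂Measure.pi μ = ∫ x, ∫ t, f (Function.update x k t) ∂μ k ∂Measure.pi μ := by
  have hmp := measurePreserving_update_pi (μ := μ) k
  refine Eq.trans ?_ (integral_prod _ (hmp.integrable_comp_of_integrable hf))
  conv_lhs => rw [← hmp.map_eq]
  exact integral_map hmp.aemeasurable (by rw [hmp.map_eq]; exact hf.aestronglyMeasurable)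

/-- A function whose mean in the `k`-th argument vanishes has zero conditional expectation given
any σ-algebra of events that do not involve the `k`-th coordinate. -/
theorem condExp_pi_ae_eq_zero {m : MeasurableSpace (∀ i, X i)} (hm : m ≤ MeasurableSpace.pi)
    {k : ι} (hmk : ∀ s, MeasurableSet[m] s → ∀ x t, Function.update x k t ∈ s ↔ x ∈ s)
    {f : (∀ i, X i) → ℝ} (hf : Integrable f (Measure.pi μ))
    (hfk : ∀ᵐ x ∂Measure.pi μ, ∫ t, f (Function.update x k t) ∂μ k = 0) :
    (Measure.pi μ)[f | m] =ᵐ[Measure.pi μ] 0 := by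
  refine (ae_eq_condExp_of_forall_setIntegral_eq hm hf (fun s _ _ => integrableOn_zero)
    (fun s hs _ => ?_) aestronglyMeasurable_zero).symm
  rw [← integral_indicator (hm s hs), ← integral_indicator (hm s hs),
    integral_pi_eq_integral_integral_update (hf.indicator (hm s hs)) k]
  simp only [Set.indicator_zero, integral_zero]
  refine (integral_eq_zero_of_ae ?_).symm
  filter_upwards [hfk] with x hx
  by_cases hxs : x ∈ s <;> simp [Set.indicator, hmk s hs, hxs, hx]

end Resampling

/-- The correlation identity `E X_i X_j = E[ξ_i ξ_j g_{ij}(ξ_i, ξ_j)]`. -/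
theorem integral_mul_withDensity_eq_integral_mul_kernel {n : ℕ} {μ : Fin n → Measure ℝ}
    [∀ i, IsProbabilityMeasure (μ i)] {g : Finset (Fin n) → (Fin n → ℝ) → ℝ}
    (hg : IsKernelSystem μ g)
    (hmean : ∀ i, Integrable (fun t : ℝ => t) (μ i) ∧ ∫ t, t ∂μ i = 0)
    {i j : Fin n} (hij : i ≠ j)
    (hintX : Integrable (fun x : Fin n → ℝ => x i * x j)
      ((Measure.pi μ).withDensity fun x => ENNReal.ofReal (1 + Usum g x)))
    (hintξ : Integrable (fun x : Fin n → ℝ => x i * x j * g {i, j} x) (Measure.pi μ)) :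
    ∫ x, x i * x j ∂(Measure.pi μ).withDensity (fun x => ENNReal.ofReal (1 + Usum g x))
      = ∫ x, x i * x j * g {i, j} x ∂Measure.pi μ := by
  obtain ⟨hker, hpos⟩ := hg
  have hU : Measurable (Usum g) :=
    Finset.measurable_sum _ fun S hS => (hker S (by simpa using hS)).1
  have hdens : Measurable fun x => ENNReal.ofReal (1 + Usum g x) :=
    (hU.const_add 1).ennreal_ofReal
  have hfin : ∀ᵐ x ∂Measure.pi μ, ENNReal.ofReal (1 + Usum g x) < ⊤ := by simp
  have hsmul : (fun x => (ENNReal.ofReal (1 + Usum g x)).toReal • (x i * x j))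
      =ᵐ[Measure.pi μ] fun x => x i * x j + x i * x j * Usum g x := by
    filter_upwards [hpos] with x hx
    rw [ENNReal.toReal_ofReal (by linarith), smul_eq_mul]
    ring
  rw [integrable_withDensity_iff_integrable_smul' hdens hfin, integrable_congr hsmul] at hintX
  rw [integral_withDensity_eq_integral_toReal_smul hdens hfin, integral_congr_ae hsmul]
  -- the coordinates are independent, integrable and centred
  have hcoord (k : Fin n) : Integrable (fun x : Fin n → ℝ => x k) (Measure.pi μ) :=
    (measurePreserving_eval μ k).integrable_comp_of_integrable (hmean k).1
  have hindep : ProbabilityTheory.IndepFun (fun x : Fin n → ℝ => x i) (fun x => x j)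
      (Measure.pi μ) :=
    (ProbabilityTheory.iIndepFun_pi (X := fun _ t => t) fun _ => aemeasurable_id).indepFun hij
  have hprod : Integrable (fun x : Fin n → ℝ => x i * x j) (Measure.pi μ) :=
    hindep.integrable_mul (hcoord i) (hcoord j)
  have hprod_zero : ∫ x : Fin n → ℝ, x i * x j ∂Measure.pi μ = 0 := by
    rw [hindep.integral_fun_mul_eq_mul_integral (hcoord i).aestronglyMeasurable
      (hcoord j).aestronglyMeasurable, integral_eval, (hmean i).2, zero_mul]
  -- the kernels other than `g {i, j}` have zero conditional expectation given `(x i, x j)`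
  let T := (Finset.univ.filter fun S : Finset (Fin n) => 2 ≤ S.card).erase {i, j}
  set h : (Fin n → ℝ) → ℝ := ∑ S ∈ T, g S with hh
  have hUsum (x : Fin n → ℝ) : Usum g x = h x + g {i, j} x := by
    rw [Usum, hh, Finset.sum_apply, Finset.sum_erase_add]
    simp [Finset.card_pair hij]
  have hTcard {S : Finset (Fin n)} (hS : S ∈ T) : 2 ≤ S.card := by
    simpa using Finset.mem_of_mem_erase hS
  have hh_int : Integrable h (Measure.pi μ) :=
    integrable_finsetSum' _ fun S hS => (hker S (hTcard hS)).2.2.1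
  have hprod_h : Integrable (fun x => x i * x j * h x) (Measure.pi μ) := by
    refine ((hintX.sub hprod).sub hintξ).congr (.of_forall fun x => ?_)
    simp only [Pi.sub_apply, hUsum]
    ring
  let π : (Fin n → ℝ) → ℝ × ℝ := fun x => (x i, x j)
  let m : MeasurableSpace (Fin n → ℝ) := MeasurableSpace.comap π inferInstance
  have hm : m ≤ MeasurableSpace.pi := Measurable.comap_le (by fun_prop)
  have hcond_g {S : Finset (Fin n)} (hS : S ∈ T) :
      (Measure.pi μ)[g S | m] =ᵐ[Measure.pi μ] 0 := by
    obtain ⟨k, hkS, hk⟩ : ∃ k ∈ S, k ∉ ({i, j} : Finset (Fin n)) := by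
      by_contra! hsub
      refine Finset.ne_of_mem_erase hS (Finset.eq_of_subset_of_card_le hsub ?_)
      rw [Finset.card_pair hij]
      exact hTcard hS
    obtain ⟨-, -, hgint, hdeg⟩ := hker S (hTcard hS)
    refine condExp_pi_ae_eq_zero hm ?_ hgint (hdeg k hkS)
    rintro _ ⟨s, -, rfl⟩ x t
    simp only [Finset.mem_insert, Finset.mem_singleton, not_or] at hk
    simp [π, Function.update_of_ne (Ne.symm hk.1), Function.update_of_ne (Ne.symm hk.2)]
  have hcond_h : (Measure.pi μ)[h | m] =ᵐ[Measure.pi μ] 0 := by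
    refine (condExp_finsetSum (fun S hS => (hker S (hTcard hS)).2.2.1) m).trans ?_
    filter_upwards [(Finset.eventually_all T).2 fun S hS => hcond_g hS] with x hx
    rw [Finset.sum_apply]
    exact Finset.sum_eq_zero hx
  have hprod_h_zero : ∫ x, x i * x j * h x ∂Measure.pi μ = 0 := by
    have hmeas : StronglyMeasurable[m] fun x : Fin n → ℝ => x i * x j :=
      ((measurable_fst.mul measurable_snd).comp (comap_measurable π)).stronglyMeasurable
    rw [← integral_condExp hm]
    refine integral_eq_zero_of_ae
      ((condExp_mul_of_stronglyMeasurable_left hmeas hprod_h hh_int).trans ?_)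
    filter_upwards [hcond_h] with x hx
    simp [hx]
  simp only [hUsum, mul_add, ← add_assoc]
  rw [integral_add (hprod.fun_add hprod_h) hintξ, integral_add hprod hprod_h, hprod_zero,
    hprod_h_zero, zero_add, zero_add]

/-- Theorem 5.4: random variables `X₁,…,Xₙ` with `E X_k = 0`, whose joint law `ν` has the
canonical representation with kernels `g` satisfying A1–A3, are orthogonal
(`E X_i X_j = 0` for all `i < j`) if and only if `E[ξ_i ξ_j g_{ij}(ξ_i, ξ_j)] = 0` for all
`i < j`. -/
theorem statement7 (n : ℕ) (μ : Fin n → Measure ℝ) [∀ i, IsProbabilityMeasure (μ i)]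
    (g : Finset (Fin n) → (Fin n → ℝ) → ℝ) (hg : IsKernelSystem μ g)
    (ν : Measure (Fin n → ℝ))
    (hrep : ν = (Measure.pi μ).withDensity fun x => ENNReal.ofReal (1 + Usum g x))
    (hmean : ∀ i, Integrable (fun t : ℝ => t) (μ i) ∧ ∫ t, t ∂μ i = 0)
    (hintX : ∀ i j : Fin n, i < j → Integrable (fun x : Fin n → ℝ => x i * x j) ν)
    (hintξ : ∀ i j : Fin n, i < j →
      Integrable (fun x : Fin n → ℝ => x i * x j * g {i, j} x) (Measure.pi μ)) :
    (∀ i j : Fin n, i < j → ∫ x, x i * x j ∂ν = 0) ↔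
      (∀ i j : Fin n, i < j → ∫ x, x i * x j * g {i, j} x ∂Measure.pi μ = 0) := by
  subst hrep
  refine forall₃_congr fun i j hij => ?_
  rw [integral_mul_withDensity_eq_integral_mul_kernel hg hmean hij.ne (hintX i j hij)
    (hintξ i j hij)]
end
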